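/- Let n ≥ 4 be an integer, ε ∈ ℂ a primitive (2n−4)-th root of unity, and set L_{n−1} = x^{n−2} − i^n·y^{n−2} and L_n = x^{n−2} + i^n·y^{n−2} in ℂ[x,y], where i is the imaginary unit. Then for every integer k ≥ 0: the space {f ∈ ℂ[x,y] : f homogeneous of degree (2k+1)(n−2), f(εx, ε^{−1}y) = −f(x,y), and f(y, −x) = (−1)^{n(k+1)+1}·i^n·f(x,y)} equals the ℂ-linear span of the k+1 polynomials L_{n−1}^{2i+1}·L_n^{2(k−i)} for 0 ≤ i ≤ k. -/

import Mathlib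

open MvPolynomial in
lemma aux_coeff (a b : ℂ) (f : MvPolynomial (Fin 2) ℂ) (s : Fin 2 →₀ ℕ) :
    coeff s (aeval ![C a * X 0, C b * X 1] f : MvPolynomial (Fin 2) ℂ)
      = a ^ s 0 * b ^ s 1 * coeff s f := by
  classical
  induction f using MvPolynomial.induction_on' with
  | monomial u c =>
    have h : (aeval ![C a * X 0, C b * X 1] (monomial u c) : MvPolynomial (Fin 2) ℂ)
        = monomial u (a ^ u 0 * b ^ u 1 * c) := by
      rw [aeval_monomial, Finsupp.prod_fintype _ _ (by simp), monomial_eq,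
        Finsupp.prod_fintype _ _ (by simp)]
      simp [Fin.prod_univ_two, mul_pow, algebraMap_eq]
      ring
    rw [h, coeff_monomial, coeff_monomial]
    split_ifs with hs
    · rw [hs]
    · simp
  | add p q hp hq => rw [map_add, coeff_add, coeff_add, hp, hq]; ring

/-- span of the products of degree `d`. -/
def auxV {R : Type*} [CommRing R] [Algebra ℂ R] (A B : R) (d : ℕ) : Submodule ℂ R :=
  Submodule.span ℂ {f | ∃ p q, p + q = d ∧ f = A ^ p * B ^ q}

lemma auxV_mulA {R : Type*} [CommRing R] [Algebra ℂ R] (A B : R) (d : ℕ) {f : R}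
    (hf : f ∈ auxV A B d) : A * f ∈ auxV A B (d + 1) := by
  have : auxV A B d ≤ (auxV A B (d + 1)).comap (LinearMap.mulLeft ℂ A) := by
    refine Submodule.span_le.2 ?_
    rintro _ ⟨p, q, h, rfl⟩
    exact Submodule.subset_span ⟨p + 1, q, by omega, by simp; ring⟩
  exact this hf

lemma auxV_mulB {R : Type*} [CommRing R] [Algebra ℂ R] (A B : R) (d : ℕ) {f : R}
    (hf : f ∈ auxV A B d) : B * f ∈ auxV A B (d + 1) := by
  have : auxV A B d ≤ (auxV A B (d + 1)).comap (LinearMap.mulLeft ℂ B) := by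
    refine Submodule.span_le.2 ?_
    rintro _ ⟨p, q, h, rfl⟩
    exact Submodule.subset_span ⟨p, q + 1, by omega, by simp; ring⟩
  exact this hf

lemma auxV_mul {R : Type*} [CommRing R] [Algebra ℂ R] (A B : R) (d : ℕ) {f u : R}
    (a b : ℂ) (hu : u = a • A + b • B)
    (hf : f ∈ auxV A B d) : u * f ∈ auxV A B (d + 1) := by
  rw [hu, add_mul, smul_mul_assoc, smul_mul_assoc]
  exact add_mem (Submodule.smul_mem _ _ (auxV_mulA A B d hf))
    (Submodule.smul_mem _ _ (auxV_mulB A B d hf))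

lemma auxV_pow {R : Type*} [CommRing R] [Algebra ℂ R] (A B : R) {u v : R}
    (a b a' b' : ℂ) (hu : u = a • A + b • B) (hv : v = a' • A + b' • B) (p q : ℕ) :
    u ^ p * v ^ q ∈ auxV A B (p + q) := by
  induction p with
  | zero =>
    induction q with
    | zero => exact Submodule.subset_span ⟨0, 0, rfl, by simp⟩
    | succ q ih =>
      have := auxV_mul A B _ a' b' hv ih
      rw [← add_assoc]
      convert this using 1
      ring
  | succ p ih =>
    have := auxV_mul A B _ a b hu ih
    rw [show p + 1 + q = p + q + 1 by ring]
    convert this using 1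
    ring


open MvPolynomial in
/-- for the binary dihedral action of type `D_n`, the isotypic piece
`{f homogeneous of degree (2k+1)(n−2), f(εx,ε⁻¹y)=−f, f(y,−x)=(−1)^{n(k+1)+1} iⁿ f}`
is spanned by the `k+1` polynomials `L_{n−1}^{2i+1} L_n^{2(k−i)}`, `0 ≤ i ≤ k`, where
`L_{n−1} = x^{n−2} − iⁿ y^{n−2}` and `L_n = x^{n−2} + iⁿ y^{n−2}`. -/
theorem stmt17 (n : ℕ) (hn : 4 ≤ n) (ε : ℂ) (hε : IsPrimitiveRoot ε (2 * n - 4)) (k : ℕ) :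
    {f : MvPolynomial (Fin 2) ℂ |
        f.IsHomogeneous ((2 * k + 1) * (n - 2)) ∧
        aeval ![C ε * X 0, C ε⁻¹ * X 1] f = -f ∧
        aeval ![X 1, -X 0] f = (((-1 : ℂ) ^ (n * (k + 1) + 1)) * Complex.I ^ n) • f}
      = (Submodule.span ℂ (Set.range (fun i : Fin (k + 1) =>
          ((X 0 ^ (n - 2) - C (Complex.I ^ n) * X 1 ^ (n - 2) : MvPolynomial (Fin 2) ℂ)
              ^ (2 * (i : ℕ) + 1)) *
          ((X 0 ^ (n - 2) + C (Complex.I ^ n) * X 1 ^ (n - 2)) ^ (2 * (k - (i : ℕ)))))) :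
            Set (MvPolynomial (Fin 2) ℂ)) := by
  obtain ⟨m, rfl⟩ : ∃ m, n = m + 2 := ⟨n - 2, by omega⟩
  have hm : 2 ≤ m := by omega
  simp only [Nat.add_sub_cancel]
  rw [show 2 * (m + 2) - 4 = 2 * m by omega] at hε
  have hε0 : ε ≠ 0 := hε.ne_zero (by omega)
  have hεm : ε ^ m = -1 := by
    have h1 : (ε ^ m - 1) * (ε ^ m + 1) = 0 := by
      have := hε.pow_eq_one
      rw [mul_comm, pow_mul] at this
      linear_combination this
    rcases mul_eq_zero.1 h1 with h | h
    · exact absurd (sub_eq_zero.1 h) (hε.pow_ne_one_of_pos_of_lt (by omega) (by omega))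
    · exact eq_neg_of_add_eq_zero_left h
  obtain ⟨J, hJ⟩ : ∃ J : ℂ, J = Complex.I ^ (m + 2) := ⟨_, rfl⟩
  obtain ⟨s, hs⟩ : ∃ s : ℂ, s = (-1) ^ m := ⟨_, rfl⟩
  have hss : s * s = 1 := by rw [hs, ← mul_pow]; simp
  have hJJ : J * J = s := by
    rw [hJ, hs, ← mul_pow, Complex.I_mul_I, pow_add]; simp
  have hJ0 : J ≠ 0 := by rw [hJ]; exact pow_ne_zero _ Complex.I_ne_zero
  have hlam : (-1 : ℂ) ^ ((m + 2) * (k + 1) + 1) * Complex.I ^ (m + 2) = -(s ^ (k + 1) * J) := by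
    rw [← hJ, pow_succ, pow_mul, pow_add (-1 : ℂ) m 2, ← hs]; ring
  rw [hlam, ← hJ]
  obtain ⟨A, hA⟩ : ∃ A : MvPolynomial (Fin 2) ℂ, A = X 0 ^ m - C J * X 1 ^ m := ⟨_, rfl⟩
  obtain ⟨B, hB⟩ : ∃ B : MvPolynomial (Fin 2) ℂ, B = X 0 ^ m + C J * X 1 ^ m := ⟨_, rfl⟩
  rw [← hA, ← hB]
  have hJJC : (C J * C J : MvPolynomial (Fin 2) ℂ) = C s := by rw [← C_mul, hJJ]
  have hssC : (C s * C s : MvPolynomial (Fin 2) ℂ) = 1 := by rw [← C_mul, hss, C_1]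
  have hsm : ((-1) ^ m : MvPolynomial (Fin 2) ℂ) = C s := by rw [hs]; simp
  have hσA : (aeval ![X 1, -X 0] A : MvPolynomial (Fin 2) ℂ) = C (-(s * J)) * A := by
    rw [hA]
    simp [algebraMap_eq]
    rw [neg_pow, hsm]
    linear_combination (-C s * X 1 ^ m) * hJJC - X 1 ^ m * hssC
  have hσB : (aeval ![X 1, -X 0] B : MvPolynomial (Fin 2) ℂ) = C (s * J) * B := by
    rw [hB]
    simp [algebraMap_eq]
    rw [neg_pow, hsm]
    linear_combination (-C s * X 1 ^ m) * hJJC - X 1 ^ m * hssC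
  have hτ : ∀ (D : ℂ), (aeval ![C ε * X 0, C ε⁻¹ * X 1]
      (X 0 ^ m + C D * X 1 ^ m : MvPolynomial (Fin 2) ℂ) : MvPolynomial (Fin 2) ℂ)
      = - (X 0 ^ m + C D * X 1 ^ m) := by
    intro D
    simp only [map_add, map_mul, map_pow, aeval_X, aeval_C, algebraMap_eq, mul_pow]
    simp only [Matrix.cons_val_zero, Matrix.cons_val_one, mul_pow, ← C_pow, inv_pow, hεm]
    simp
    ring
  have hτB : (aeval ![C ε * X 0, C ε⁻¹ * X 1] B : MvPolynomial (Fin 2) ℂ) = -B := by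
    rw [hB]; exact hτ J
  have hτA : (aeval ![C ε * X 0, C ε⁻¹ * X 1] A : MvPolynomial (Fin 2) ℂ) = -A := by
    have := hτ (-J)
    rw [C_neg, neg_mul, ← sub_eq_add_neg, ← hA] at this
    exact this
  have hmonX : ∀ j : Fin 2, (X j ^ m : MvPolynomial (Fin 2) ℂ).IsHomogeneous m := fun j => by
    simpa using (isHomogeneous_X ℂ j).pow m
  have hmonC : (C J * X 1 ^ m : MvPolynomial (Fin 2) ℂ).IsHomogeneous m := by
    simpa using (isHomogeneous_C (Fin 2) J).mul (hmonX 1)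
  have hAh : A.IsHomogeneous m := by rw [hA]; exact (hmonX 0).sub hmonC
  have hBh : B.IsHomogeneous m := by rw [hB]; exact (hmonX 0).add hmonC
  have hσ : ∀ p q, p + q = 2 * k + 1 → (aeval ![X 1, -X 0] (A ^ p * B ^ q) :
      MvPolynomial (Fin 2) ℂ) = ((-1) ^ p * (s ^ (k + 1) * J)) • (A ^ p * B ^ q) := by
    intro p q hpq
    rw [map_mul, map_pow, map_pow, hσA, hσB, smul_eq_C_mul]
    have : (-(s * J)) ^ p * (s * J) ^ q = (-1) ^ p * (s ^ (k + 1) * J) := by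
      rw [neg_pow, mul_assoc, ← pow_add, hpq]
      have : s * J * (s * J) = s := by linear_combination s * s * hJJ + s * hss
      rw [pow_succ, pow_mul, pow_two, this]; ring
    rw [← this, C_mul (a := (-(s * J)) ^ p), C_pow, C_pow]
    ring
  ext f
  simp only [Set.mem_setOf_eq, SetLike.mem_coe]
  constructor
  · rintro ⟨hf, h1, h2⟩
    have hfV : f ∈ auxV A B (2 * k + 1) := by
      rw [f.as_sum]
      refine Submodule.sum_mem _ fun t ht => ?_
      have hc : coeff t f ≠ 0 := mem_support_iff.1 ht
      have hdeg : t 0 + t 1 = (2 * k + 1) * m := by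
        have := hf hc
        rw [Finsupp.weight_apply, Finsupp.sum_fintype _ _ (by simp)] at this
        simpa [Fin.sum_univ_two] using this
      have h3 := congrArg (coeff t) h1
      rw [aux_coeff, coeff_neg] at h3
      have h4 : ε ^ t 0 * ε⁻¹ ^ t 1 = -1 := mul_right_cancel₀ hc (by rw [h3]; ring)
      have h5 : ε ^ t 0 = - ε ^ t 1 := by
        rw [inv_pow] at h4
        have := pow_ne_zero (t 1) hε0
        field_simp at h4
        exact h4
      have h6 : ε ^ (2 * t 0) = 1 := by
        have h7 : ε ^ (t 0 + t 1) = -1 := by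
          rw [hdeg, mul_comm, pow_mul, hεm, pow_succ, pow_mul]; simp
        rw [pow_add] at h7
        rw [two_mul, pow_add]
        linear_combination ε ^ t 0 * h5 - h7
      have h8 : 2 * m ∣ 2 * t 0 := hε.dvd_of_pow_eq_one _ h6
      obtain ⟨a, ha⟩ := Nat.dvd_of_mul_dvd_mul_left (by norm_num) h8
      have h9 : m ∣ t 1 := by
        rw [← Nat.dvd_add_right (Dvd.intro a ha.symm : m ∣ t 0), hdeg]
        exact Dvd.intro_left _ rfl
      obtain ⟨b, hb⟩ := h9
      have hab : a + b = 2 * k + 1 := by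
        rw [ha, hb, ← mul_add, mul_comm] at hdeg
        exact Nat.eq_of_mul_eq_mul_right (by omega) hdeg
      rw [monomial_eq, Finsupp.prod_fintype _ _ (by simp), Fin.prod_univ_two, ha, hb, pow_mul,
        pow_mul, ← smul_eq_C_mul, ← hab]
      refine Submodule.smul_mem _ _ (auxV_pow A B (1 / 2) (1 / 2) (-(1 / (2 * J))) (1 / (2 * J))
        ?_ ?_ a b)
      · rw [hA, hB, ← smul_add, sub_add_add_cancel, ← two_smul ℂ (X 0 ^ m), smul_smul]
        norm_num
      · rw [hA, hB, neg_smul, neg_add_eq_sub, ← smul_sub, add_sub_sub_cancel,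
          ← two_smul ℂ, ← smul_eq_C_mul, smul_smul, smul_smul]
        rw [show 1 / (2 * J) * 2 * J = 1 by field_simp, one_smul]
    obtain ⟨l, hl⟩ : ∃ l : ℂ, l = s ^ (k + 1) * J := ⟨_, rfl⟩
    have hl0 : l ≠ 0 := by
      rw [hl]; exact mul_ne_zero (pow_ne_zero _ (left_ne_zero_of_mul_eq_one hss)) hJ0
    rw [← hl] at h2
    let σ : MvPolynomial (Fin 2) ℂ →ₗ[ℂ] MvPolynomial (Fin 2) ℂ :=
      (aeval ![X 1, -X 0] : MvPolynomial (Fin 2) ℂ →ₐ[ℂ] MvPolynomial (Fin 2) ℂ).toLinearMap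
    let φ : MvPolynomial (Fin 2) ℂ →ₗ[ℂ] MvPolynomial (Fin 2) ℂ := l • LinearMap.id - σ
    have hφ : ∀ g, φ g = l • g - aeval ![X 1, -X 0] g := fun g => rfl
    have hφf : φ f = (2 * l) • f := by rw [hφ, h2, ← sub_smul]; congr 1; ring
    have key : auxV A B (2 * k + 1) ≤ (Submodule.span ℂ (Set.range (fun i : Fin (k + 1) =>
        A ^ (2 * (i : ℕ) + 1) * B ^ (2 * (k - (i : ℕ)))))).comap φ := by
      refine Submodule.span_le.2 ?_
      rintro _ ⟨p, q, hpq, rfl⟩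
      simp only [SetLike.mem_coe, Submodule.mem_comap]
      rw [hφ, hσ p q hpq, ← sub_smul, ← hl]
      rcases Nat.even_or_odd' p with ⟨c, rfl | rfl⟩
      · simp
      · refine Submodule.smul_mem _ _ (Submodule.subset_span ⟨⟨c, by omega⟩, ?_⟩)
        simp only
        congr 2
        omega
    have := key hfV
    rw [Submodule.mem_comap, hφf] at this
    exact (Submodule.smul_mem_iff _ (mul_ne_zero two_ne_zero hl0)).1 this
  · intro hf
    induction hf using Submodule.span_induction with
    | mem x hx =>
      obtain ⟨i, rfl⟩ := hx
      have hi : 2 * (i : ℕ) + 1 + 2 * (k - (i : ℕ)) = 2 * k + 1 := by omega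
      refine ⟨?_, ?_, ?_⟩
      · have := (hAh.pow (2 * (i : ℕ) + 1)).mul (hBh.pow (2 * (k - (i : ℕ))))
        rw [← mul_add, hi, mul_comm m] at this
        exact this
      · simp only [map_mul, map_pow, hτA, hτB]
        rw [Odd.neg_pow ⟨_, rfl⟩, Even.neg_pow ⟨k - i, by ring⟩]
        ring
      · simp only
        rw [hσ _ _ hi, Odd.neg_one_pow ⟨_, rfl⟩]
        congr 1
        ring
    | zero => exact ⟨isHomogeneous_zero _ _ _, by simp, by simp⟩
    | add x y _ _ hx hy =>
      refine ⟨hx.1.add hy.1, ?_, ?_⟩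
      · rw [map_add, hx.2.1, hy.2.1]; ring
      · rw [map_add, hx.2.2, hy.2.2, smul_add]
    | smul c x _ hx =>
      refine ⟨?_, ?_, ?_⟩
      · have := (isHomogeneous_C (Fin 2) c).mul hx.1
        rw [zero_add] at this
        rwa [smul_eq_C_mul]
      · rw [map_smul, hx.2.1, smul_neg]
      · rw [map_smul, hx.2.2, smul_comm]
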